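/- Let n ≥ 1 and let A_L = circ(L₀, L₁, …, L_{n-1}) be the n×n circulant matrix whose entries are the first n Lucas numbers. Then the spectral norm of A_L satisfies ‖A_L‖₂ = F_{n+2} + F_n − 1, where F_k denotes the k-th Fibonacci number. -/

import Mathlib

/-- The Lucas numbers: `L₀ = 2`, `L₁ = 1`, `Lₙ = Lₙ₋₁ + Lₙ₋₂`. -/
def lucas : ℕ → ℕ
  | 0 => 2
  | 1 => 1
  | n + 2 => lucas (n + 1) + lucas n

/-- The `n × n` circulant matrix whose `(i,j)` entry is `x ((j - i) mod n)`. -/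
def circMatrix {n : ℕ} (x : Fin n → ℝ) : Matrix (Fin n) (Fin n) ℝ :=
  Matrix.of fun i j => x (j - i)

/-- A matrix with nonnegative entries whose row and column sums are all equal to `S` has
spectral norm `S`. -/
theorem norm_toEuclideanCLM_of_sum_eq {ι : Type*} [Fintype ι] [DecidableEq ι] [Nonempty ι]
    {A : Matrix ι ι ℝ} {S : ℝ} (hA : ∀ i j, 0 ≤ A i j) (hrow : ∀ i, ∑ j, A i j = S)
    (hcol : ∀ j, ∑ i, A i j = S) : ‖Matrix.toEuclideanCLM (𝕜 := ℝ) A‖ = S := by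
  have hS : 0 ≤ S := by
    obtain ⟨i⟩ := ‹Nonempty ι›
    exact hrow i ▸ Finset.sum_nonneg fun j _ => hA i j
  apply le_antisymm
  · refine ContinuousLinearMap.opNorm_le_bound _ hS fun x => ?_
    refine (sq_le_sq₀ (norm_nonneg _) (by positivity)).1 ?_
    rw [mul_pow, EuclideanSpace.real_norm_sq_eq, EuclideanSpace.real_norm_sq_eq]
    calc ∑ i, (Matrix.toEuclideanCLM (𝕜 := ℝ) A x) i ^ 2
        = ∑ i, (∑ j, A i j * x j) ^ 2 := by
          simp [Matrix.ofLp_toEuclideanCLM, Matrix.mulVec, dotProduct]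
      _ ≤ ∑ i, (∑ j, A i j) * ∑ j, A i j * x j ^ 2 := by
          refine Finset.sum_le_sum fun i _ => ?_
          exact Finset.sum_sq_le_sum_mul_sum_of_sq_le_mul _ (fun j _ => hA i j)
            (fun j _ => mul_nonneg (hA i j) (sq_nonneg _)) fun j _ => le_of_eq (by ring)
      _ = S * ∑ j, (∑ i, A i j) * x j ^ 2 := by
          simp_rw [hrow, ← Finset.mul_sum, Finset.sum_mul]
          rw [Finset.sum_comm]
      _ = S ^ 2 * ∑ j, x j ^ 2 := by
          simp_rw [hcol, ← Finset.mul_sum]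
          ring
  · set v : EuclideanSpace ℝ ι := WithLp.toLp 2 fun _ => 1 with hv
    have hv0 : 0 < ‖v‖ := norm_pos_iff.2 fun h => by
      obtain ⟨i⟩ := ‹Nonempty ι›
      simpa [hv] using congrArg (fun w : EuclideanSpace ℝ ι => w i) h
    have hAv : Matrix.toEuclideanCLM (𝕜 := ℝ) A v = S • v := by
      ext i
      simp [hv, Matrix.mulVec, dotProduct, hrow]
    have h := (Matrix.toEuclideanCLM (𝕜 := ℝ) A).le_opNorm v
    rw [hAv, norm_smul, Real.norm_of_nonneg hS] at h
    exact le_of_mul_le_mul_right h hv0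

/-- A circulant matrix with nonnegative entries has spectral norm the sum of its first row. -/
theorem norm_toEuclideanCLM_circMatrix {n : ℕ} [NeZero n] {x : Fin n → ℝ} (hx : ∀ i, 0 ≤ x i) :
    ‖Matrix.toEuclideanCLM (𝕜 := ℝ) (circMatrix x)‖ = ∑ i, x i :=
  norm_toEuclideanCLM_of_sum_eq (fun _ _ => hx _)
    (fun i => Equiv.sum_comp (Equiv.subRight i) x) fun j => Equiv.sum_comp (Equiv.subLeft j) x

theorem lucas_add_one_eq_fib (n : ℕ) : lucas (n + 1) = Nat.fib (n + 2) + Nat.fib n := by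
  induction n using Nat.twoStepInduction with
  | zero => rfl
  | one => rfl
  | more n ih₁ ih₂ =>
    have h₁ := Nat.fib_add_two (n := n + 2)
    have h₂ := Nat.fib_add_two (n := n)
    have h₃ : lucas (n + 2 + 1) = lucas (n + 1 + 1) + lucas (n + 1) := rfl
    simp only [add_assoc, Nat.reduceAdd] at *
    omega

theorem sum_range_lucas_add_one (n : ℕ) :
    ∑ i ∈ Finset.range n, lucas i + 1 = lucas (n + 1) := by
  induction n with
  | zero => rfl
  | succ n ih =>
    have h : lucas (n + 1 + 1) = lucas (n + 1) + lucas n := rfl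
    rw [Finset.sum_range_succ]
    omega

theorem spectral_norm_circulant_lucas (n : ℕ) (hn : 1 ≤ n) :
    ‖Matrix.toEuclideanCLM (𝕜 := ℝ)
        (circMatrix (fun i : Fin n => (lucas i : ℝ)))‖ =
      (Nat.fib (n + 2) : ℝ) + Nat.fib n - 1 := by
  have : NeZero n := ⟨by omega⟩
  rw [norm_toEuclideanCLM_circMatrix fun _ => Nat.cast_nonneg _,
    Fin.sum_univ_eq_sum_range (fun i => (lucas i : ℝ)), eq_sub_iff_add_eq]
  exact_mod_cast (sum_range_lucas_add_one n).trans (lucas_add_one_eq_fib n)
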